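/- arXiv:2601.04125 — 2 statements merged into one kernel-verified Lean document; each statement's English description precedes it below -/
import Mathlib

section
/- Suppose F = F_q is the finite field with q elements and 1 < k < n−1. Then T^c(Y) is a maximal clique of Δ_k(V) for every non-degenerate (k+1)-dimensional subspace Y of F^n if and only if [k+1]_q − (q+1) > n, where [t]_q = (q^t − 1)/(q − 1) = q^{t−1} + ⋯ + q + 1. -/
open Module

section Defs

variable (F : Type*) [Field F]

/-- The `i`-th coordinate hyperplane in `F^n`: the kernel of the `i`-th coordinate functional. -/
def coordHyp (n : ℕ) (i : Fin n) : Submodule F (Fin n → F) :=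
  LinearMap.ker (LinearMap.proj (R := F) (φ := fun _ : Fin n => F) i)

/-- A subspace of `F^n` is degenerate if it is contained in some coordinate hyperplane. -/
def IsDeg (n : ℕ) (W : Submodule F (Fin n → F)) : Prop :=
  ∃ i : Fin n, W ≤ coordHyp F n i

/-- A subspace of `F^n` is non-degenerate if it is not degenerate. -/
def IsNondeg (n : ℕ) (W : Submodule F (Fin n → F)) : Prop :=
  ¬ IsDeg F n W

/-- Adjacency of `k`-dimensional subspaces: distinct with `(k-1)`-dimensional intersection. -/
def AdjK (n k : ℕ) (A B : Submodule F (Fin n → F)) : Prop :=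
  A ≠ B ∧ finrank F ↥(A ⊓ B) = k - 1

/-- The star `S(X)`: all `k`-dimensional subspaces containing `X`. -/
def Sstar (n k : ℕ) (X : Submodule F (Fin n → F)) : Set (Submodule F (Fin n → F)) :=
  {A | finrank F ↥A = k ∧ X ≤ A}

/-- `S^c(X)`: all non-degenerate `k`-dimensional subspaces containing `X`. -/
def Sc (n k : ℕ) (X : Submodule F (Fin n → F)) : Set (Submodule F (Fin n → F)) :=
  {A | finrank F ↥A = k ∧ X ≤ A ∧ IsNondeg F n A}

/-- `T^c(Y)`: all non-degenerate `k`-dimensional subspaces contained in `Y`. -/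
def Tc (n k : ℕ) (Y : Submodule F (Fin n → F)) : Set (Submodule F (Fin n → F)) :=
  {A | finrank F ↥A = k ∧ A ≤ Y ∧ IsNondeg F n A}

/-- A clique of `Δ_k(V)`: a set of non-degenerate `k`-dimensional subspaces which are
pairwise adjacent. -/
def IsCliqueD (n k : ℕ) (C : Set (Submodule F (Fin n → F))) : Prop :=
  (∀ A ∈ C, finrank F ↥A = k ∧ IsNondeg F n A) ∧
    ∀ A ∈ C, ∀ B ∈ C, A ≠ B → AdjK F n k A B

/-- A maximal clique of `Δ_k(V)`. -/
def IsMaxCliqueD (n k : ℕ) (C : Set (Submodule F (Fin n → F))) : Prop :=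
  IsCliqueD F n k C ∧ ∀ D, IsCliqueD F n k D → C ⊆ D → D = C

/-- A star of `Δ_k(V)`: a set `S^c(X)` which is a maximal clique of `Δ_k(V)`. -/
def IsStarD (n k : ℕ) (S : Set (Submodule F (Fin n → F))) : Prop :=
  (∃ X : Submodule F (Fin n → F), finrank F ↥X = k - 1 ∧ S = Sc F n k X) ∧
    IsMaxCliqueD F n k S

/-- A top of `Δ_k(V)`: a set `T^c(Y)` which is a maximal clique of `Δ_k(V)`. -/
def IsTopD (n k : ℕ) (T : Set (Submodule F (Fin n → F))) : Prop :=
  (∃ Y : Submodule F (Fin n → F), finrank F ↥Y = k + 1 ∧ T = Tc F n k Y) ∧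
    IsMaxCliqueD F n k T

/-- Adjacency of maximal cliques used in the graphs `Δ_s` and `Δ_t`:
two distinct cliques such that every vertex of each is adjacent to some vertex of the other. -/
def AdjMC (n k : ℕ) (C1 C2 : Set (Submodule F (Fin n → F))) : Prop :=
  C1 ≠ C2 ∧ (∀ A ∈ C1, ∃ B ∈ C2, AdjK F n k A B) ∧
    (∀ A ∈ C2, ∃ B ∈ C1, AdjK F n k A B)

/-- Adjacency in the graphs `Δ'_s` and `Δ'_t`: adjacent as above with empty intersection. -/
def AdjMC' (n k : ℕ) (C1 C2 : Set (Submodule F (Fin n → F))) : Prop :=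
  AdjMC F n k C1 C2 ∧ C1 ∩ C2 = ∅

/-- A clique of the graph `Δ_s` (whose vertices are the stars of `Δ_k(V)`). -/
def IsCliqueDs (n k : ℕ) (𝔖 : Set (Set (Submodule F (Fin n → F)))) : Prop :=
  (∀ S ∈ 𝔖, IsStarD F n k S) ∧ ∀ S ∈ 𝔖, ∀ S' ∈ 𝔖, S ≠ S' → AdjMC F n k S S'

/-- A maximal clique of `Δ_s`. -/
def IsMaxCliqueDs (n k : ℕ) (𝔖 : Set (Set (Submodule F (Fin n → F)))) : Prop :=
  IsCliqueDs F n k 𝔖 ∧ ∀ 𝔖', IsCliqueDs F n k 𝔖' → 𝔖 ⊆ 𝔖' → 𝔖' = 𝔖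

/-- A clique of the graph `Δ'_s`. -/
def IsCliqueDs' (n k : ℕ) (𝔖 : Set (Set (Submodule F (Fin n → F)))) : Prop :=
  (∀ S ∈ 𝔖, IsStarD F n k S) ∧ ∀ S ∈ 𝔖, ∀ S' ∈ 𝔖, S ≠ S' → AdjMC' F n k S S'

/-- A maximal clique of `Δ'_s`. -/
def IsMaxCliqueDs' (n k : ℕ) (𝔖 : Set (Set (Submodule F (Fin n → F)))) : Prop :=
  IsCliqueDs' F n k 𝔖 ∧ ∀ 𝔖', IsCliqueDs' F n k 𝔖' → 𝔖 ⊆ 𝔖' → 𝔖' = 𝔖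

/-- A special set of stars: a maximal clique in both `Δ_s` and `Δ'_s`. -/
def IsSpecialStars (n k : ℕ) (𝔖 : Set (Set (Submodule F (Fin n → F)))) : Prop :=
  IsMaxCliqueDs F n k 𝔖 ∧ IsMaxCliqueDs' F n k 𝔖

/-- A clique of the graph `Δ_t` (whose vertices are the tops of `Δ_k(V)`). -/
def IsCliqueDt (n k : ℕ) (𝔗 : Set (Set (Submodule F (Fin n → F)))) : Prop :=
  (∀ T ∈ 𝔗, IsTopD F n k T) ∧ ∀ T ∈ 𝔗, ∀ T' ∈ 𝔗, T ≠ T' → AdjMC F n k T T'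

/-- A maximal clique of `Δ_t`. -/
def IsMaxCliqueDt (n k : ℕ) (𝔗 : Set (Set (Submodule F (Fin n → F)))) : Prop :=
  IsCliqueDt F n k 𝔗 ∧ ∀ 𝔗', IsCliqueDt F n k 𝔗' → 𝔗 ⊆ 𝔗' → 𝔗' = 𝔗

/-- A clique of the graph `Δ'_t`. -/
def IsCliqueDt' (n k : ℕ) (𝔗 : Set (Set (Submodule F (Fin n → F)))) : Prop :=
  (∀ T ∈ 𝔗, IsTopD F n k T) ∧ ∀ T ∈ 𝔗, ∀ T' ∈ 𝔗, T ≠ T' → AdjMC' F n k T T'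

/-- A maximal clique of `Δ'_t`. -/
def IsMaxCliqueDt' (n k : ℕ) (𝔗 : Set (Set (Submodule F (Fin n → F)))) : Prop :=
  IsCliqueDt' F n k 𝔗 ∧ ∀ 𝔗', IsCliqueDt' F n k 𝔗' → 𝔗 ⊆ 𝔗' → 𝔗' = 𝔗

/-- A special set of tops: a maximal clique in both `Δ_t` and `Δ'_t`. -/
def IsSpecialTops (n k : ℕ) (𝔗 : Set (Set (Submodule F (Fin n → F)))) : Prop :=
  IsMaxCliqueDt F n k 𝔗 ∧ IsMaxCliqueDt' F n k 𝔗

/-- `𝔗_X`: the set of all `T^c(Y)` over non-degenerate `(k+1)`-dimensional `Y` containing `X`. -/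
def TopsThrough (n k : ℕ) (X : Submodule F (Fin n → F)) :
    Set (Set (Submodule F (Fin n → F))) :=
  {T | ∃ Y : Submodule F (Fin n → F),
    finrank F ↥Y = k + 1 ∧ IsNondeg F n Y ∧ X ≤ Y ∧ T = Tc F n k Y}

end Defs

open scoped LinearAlgebra.Projectivization

lemma Submodule.exists_finrank_eq_of_le {K E : Type*} [Field K] [AddCommGroup E] [Module K E]
    [FiniteDimensional K E] {m : ℕ} (hm : m ≤ finrank K E) :
    ∃ X : Submodule K E, finrank K X = m := by
  obtain ⟨f, hf⟩ := exists_linearIndependent_of_le_finrank hm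
  exact ⟨Submodule.span K (Set.range f), by simpa using finrank_span_eq_card hf⟩

lemma Submodule.eq_ker_of_le_ker {K E : Type*} [Field K] [AddCommGroup E] [Module K E]
    [FiniteDimensional K E] {A : Submodule K E} (hA : finrank K A + 1 = finrank K E)
    {a : Dual K E} (ha : a ≠ 0) (h : A ≤ LinearMap.ker a) : A = LinearMap.ker a := by
  have := Dual.finrank_ker_add_one_of_ne_zero ha
  exact Submodule.eq_of_le_of_finrank_eq h (by omega)

/-- The points of a projective space lying on a line number one more than the scalars. -/
lemma Projectivization.card_rep_mem_of_finrank_two {K D : Type*} [Field K] [Finite K]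
    [AddCommGroup D] [Module K D] (P : Submodule K D) (hP : finrank K P = 2) :
    Nat.card {p : ℙ K D // p.rep ∈ P} = Nat.card K + 1 := by
  rw [← Projectivization.card_of_finrank_two K P hP]
  let g : ℙ K P → ℙ K D := Projectivization.map P.subtype P.injective_subtype
  have hg : Function.Injective g := Projectivization.map_injective _ _
  have hr : Set.range g = {p | p.rep ∈ P} := by
    ext p
    constructor
    · rintro ⟨x, rfl⟩
      induction x using Projectivization.ind with
      | h v hv =>
        obtain ⟨a, ha⟩ := Projectivization.exists_smul_eq_mk_rep K (P.subtype v)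
          (by simpa using hv)
        change (Projectivization.mk K (P.subtype v) _).rep ∈ P
        rw [← ha]
        exact P.smul_mem _ v.2
    · intro hp
      refine ⟨Projectivization.mk K ⟨p.rep, hp⟩ (by simpa using p.rep_nonzero), ?_⟩
      change Projectivization.mk K p.rep _ = p
      exact p.mk_rep
  rw [Nat.card_congr (Equiv.ofInjective g hg), hr]
  rfl

lemma finrank_inf_of_finrank_succ {K E : Type*} [Field K] [AddCommGroup E] [Module K E]
    [FiniteDimensional K E] {k : ℕ} {Y A B : Submodule K E} (hY : finrank K Y = k + 1)
    (hA : finrank K A = k) (hB : finrank K B = k) (hAY : A ≤ Y) (hBY : B ≤ Y) (hAB : A ≠ B) :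
    finrank K ↥(A ⊓ B) = k - 1 := by
  have h1 := Submodule.finrank_sup_add_finrank_inf_eq A B
  have h2 : finrank K ↥(A ⊔ B) ≤ k + 1 := hY ▸ Submodule.finrank_mono (sup_le hAY hBY)
  have h3 : finrank K ↥(A ⊓ B) < k := by
    rw [← hA]
    refine Submodule.finrank_lt_finrank_of_lt (lt_of_le_of_ne inf_le_left fun h => hAB ?_)
    exact Submodule.eq_of_le_of_finrank_eq (inf_eq_left.1 h) (by omega)
  omega

lemma isCliqueD_Tc {F : Type*} [Field F] {n k : ℕ} {Y : Submodule F (Fin n → F)}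
    (hY : finrank F Y = k + 1) : IsCliqueD F n k (Tc F n k Y) :=
  ⟨fun _ hA => ⟨hA.1, hA.2.2⟩, fun _ hA _ hB h =>
    ⟨h, finrank_inf_of_finrank_succ hY hA.1 hB.1 hA.2.1 hB.2.1 h⟩⟩

/-- If `[k+1]_q - (q+1) > n` and `Y` is non-degenerate, then the members of `T^c(Y)` have no common
`(k-1)`-dimensional subspace. -/
lemma exists_mem_Tc_not_le {F : Type*} [Field F] [Finite F] {n k : ℕ} (hk : 1 ≤ k)
    (hc : n + (Nat.card F + 1) < ∑ i ∈ Finset.range (k + 1), Nat.card F ^ i)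
    {Y : Submodule F (Fin n → F)} (hY : finrank F Y = k + 1) (hYn : IsNondeg F n Y)
    {X : Submodule F (Fin n → F)} (hXY : X ≤ Y) (hX : finrank F X = k - 1) :
    ∃ A ∈ Tc F n k Y, ¬ X ≤ A := by
  by_contra! hall
  let c : Fin n → Dual F Y := fun i => (LinearMap.proj i).comp Y.subtype
  have hc0 : ∀ i, c i ≠ 0 := fun i h => hYn ⟨i, fun y hy => by
    simpa [c, coordHyp] using LinearMap.congr_fun h ⟨y, hy⟩⟩
  let X' : Submodule F Y := X.comap Y.subtype
  have hX' : finrank F X' = k - 1 := by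
    rw [← hX]
    exact (Submodule.comapSubtypeEquivOfLe hXY).finrank_eq
  let P : Submodule F (Dual F Y) := X'.dualAnnihilator
  have hP : finrank F P = 2 := by
    have := Subspace.finrank_add_finrank_dualAnnihilator_eq X'
    simp only [P]
    omega
  have hfin : Finite (Dual F Y) := Module.finite_of_finite F
  have hcover : Function.Surjective
      (Sum.elim (fun i => Projectivization.mk F (c i) (hc0 i)) Subtype.val :
        Fin n ⊕ {p : ℙ F (Dual F Y) // p.rep ∈ P} → ℙ F (Dual F Y)) := by
    intro p
    let A : Submodule F (Fin n → F) := (LinearMap.ker p.rep).map Y.subtype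
    have hkr := Dual.finrank_ker_add_one_of_ne_zero p.rep_nonzero
    have hA : finrank F A = k := by
      have := (Submodule.equivMapOfInjective Y.subtype Y.injective_subtype
        (LinearMap.ker p.rep)).finrank_eq
      simp only [A]
      omega
    by_cases hd : IsDeg F n A
    · obtain ⟨i, hi⟩ := hd
      refine ⟨Sum.inl i, ?_⟩
      have hle : LinearMap.ker p.rep ≤ LinearMap.ker (c i) := fun y hy =>
        hi (Submodule.mem_map_of_mem hy)
      have hmem : c i ∈ Submodule.span F (Set.range fun _ : Unit => p.rep) :=
        mem_span_of_iInf_ker_le_ker (by simpa using hle)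
      obtain ⟨a, ha⟩ := Submodule.mem_span_singleton.1 (by simpa using hmem)
      change Projectivization.mk F (c i) (hc0 i) = p
      conv_rhs => rw [← p.mk_rep]
      exact (Projectivization.mk_eq_mk_iff' _ _ _ _ _).2 ⟨a, ha⟩
    · have hXA := hall A ⟨hA, Submodule.map_subtype_le _ _, hd⟩
      refine ⟨Sum.inr ⟨p, ?_⟩, rfl⟩
      refine (Submodule.mem_dualAnnihilator _).2 fun y hy => ?_
      obtain ⟨z, hz, hzy⟩ := hXA hy
      rw [← Subtype.ext hzy]
      exact hz
  have h := Nat.card_le_card_of_surjective _ hcover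
  rw [Nat.card_sum, Projectivization.card_rep_mem_of_finrank_two P hP,
    Projectivization.card_of_finrank F (Dual F Y) (Subspace.dual_finrank_eq.trans hY),
    Nat.card_fin] at h
  omega

lemma isMaxCliqueD_Tc {F : Type*} [Field F] {n k : ℕ} (hk : 1 ≤ k)
    {Y : Submodule F (Fin n → F)} (hY : finrank F Y = k + 1)
    (hT : ∀ X ≤ Y, finrank F X = k - 1 → ∃ A ∈ Tc F n k Y, ¬ X ≤ A) :
    IsMaxCliqueD F n k (Tc F n k Y) := by
  refine ⟨isCliqueD_Tc hY, fun D hD hsub => (Set.Subset.antisymm hsub fun B hB => ?_).symm⟩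
  obtain ⟨hBk, hBn⟩ := hD.1 B hB
  by_contra hBT
  have hBY : ¬ B ≤ Y := fun h => hBT ⟨hBk, h, hBn⟩
  have hlt : finrank F ↥(B ⊓ Y) < k := by
    rw [← hBk]
    exact Submodule.finrank_lt_finrank_of_lt (inf_lt_left.2 hBY)
  have hle : ∀ A ∈ Tc F n k Y, A ⊓ B = B ⊓ Y := fun A hA => by
    have := (hD.2 A (hsub hA) B hB fun h => hBT (h ▸ hA)).2
    exact Submodule.eq_of_le_of_finrank_le (le_inf inf_le_right (inf_le_left.trans hA.2.1))
      (by omega)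
  obtain ⟨X, hX⟩ := Submodule.exists_finrank_eq_of_le (K := F) (E := Y) (m := k - 1) (by omega)
  obtain ⟨A, hA, -⟩ := hT (X.map Y.subtype) (Submodule.map_subtype_le _ _) (by
    rw [← hX]
    exact (Submodule.equivMapOfInjective Y.subtype Y.injective_subtype X).finrank_eq.symm)
  have hk1 := (hD.2 A (hsub hA) B hB fun h => hBT (h ▸ hA)).2
  obtain ⟨A', hA', hnot⟩ := hT (B ⊓ Y) inf_le_right (by rw [← hle A hA, hk1])
  exact hnot (hle A' hA' ▸ inf_le_left)

/-- A common non-degenerate `(k-1)`-dimensional subspace of the members of `T^c(Y)` prevents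
`T^c(Y)` from being a maximal clique. -/
lemma not_isMaxCliqueD_Tc {F : Type*} [Field F] {n k : ℕ} (hk : 1 ≤ k) (hkn : k + 1 < n)
    {Y : Submodule F (Fin n → F)} (hY : finrank F Y = k + 1)
    {X : Submodule F (Fin n → F)} (hXY : X ≤ Y) (hX : finrank F X = k - 1)
    (hXn : IsNondeg F n X) (hT : ∀ A ∈ Tc F n k Y, X ≤ A) :
    ¬ IsMaxCliqueD F n k (Tc F n k Y) := by
  intro hmax
  have hlt : Y < ⊤ := by
    refine lt_top_iff_ne_top.2 fun h => ?_
    rw [h, finrank_top, Module.finrank_fin_fun] at hY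
    omega
  obtain ⟨v, -, hv⟩ := SetLike.exists_of_lt hlt
  let B := X ⊔ Submodule.span F {v}
  have hXB : X ≤ B := le_sup_left
  have hvB : v ∈ B := Submodule.mem_sup_right (Submodule.mem_span_singleton_self v)
  have hBY : ¬ B ≤ Y := fun h => hv (h hvB)
  have hBk : finrank F B = k := by
    have h1 := Submodule.finrank_add_le_finrank_add_finrank X (Submodule.span F {v})
    have h2 := finrank_span_singleton (K := F) (v := v) fun h => hv (h ▸ Y.zero_mem)
    have h3 : finrank F X < finrank F B := Submodule.finrank_lt_finrank_of_lt
      (lt_of_le_of_ne hXB fun h => hBY (h ▸ hXY))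
    have h4 : finrank F B ≤ finrank F X + finrank F (Submodule.span F {v}) := h1
    omega
  have hBn : IsNondeg F n B := fun ⟨i, hi⟩ => hXn ⟨i, hXB.trans hi⟩
  have hAB : ∀ A ∈ Tc F n k Y, A ≠ B ∧ finrank F ↥(A ⊓ B) = k - 1 := fun A hA => by
    have hne : A ≠ B := fun h => hBY (h ▸ hA.2.1)
    have h1 : finrank F X ≤ finrank F ↥(A ⊓ B) :=
      Submodule.finrank_mono (le_inf (hT A hA) hXB)
    have h2 : finrank F ↥(A ⊓ B) < finrank F B := Submodule.finrank_lt_finrank_of_lt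
      (inf_lt_right.2 fun h => hBY (h.trans hA.2.1))
    exact ⟨hne, by omega⟩
  have hins : IsCliqueD F n k (insert B (Tc F n k Y)) := by
    refine ⟨?_, ?_⟩
    · rintro A (rfl | hA)
      · exact ⟨hBk, hBn⟩
      · exact hmax.1.1 A hA
    · rintro A (rfl | hA) A' (rfl | hA') hne
      · exact absurd rfl hne
      · exact ⟨hne, inf_comm A' _ ▸ (hAB A' hA').2⟩
      · exact hAB A hA
      · exact hmax.1.2 A hA A' hA' hne
  have := hmax.2 _ hins (Set.subset_insert _ _)
  exact hBY (this ▸ Set.mem_insert B _ : B ∈ Tc F n k Y).2.1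

/-- When there are at most `n` points off a line in the dual space of `F^(k+1)`, they can be used
as the coordinates of a `(k+1)`-dimensional `Y` with a common non-degenerate `(k-1)`-dimensional
subspace of the members of `T^c(Y)`. -/
lemma exists_Tc_le {F : Type*} [Field F] [Finite F] {n k : ℕ} (hk : 1 < k)
    (hc : ∑ i ∈ Finset.range (k + 1), Nat.card F ^ i ≤ n + (Nat.card F + 1)) :
    ∃ X Y : Submodule F (Fin n → F), finrank F Y = k + 1 ∧ X ≤ Y ∧ finrank F X = k - 1 ∧
      IsNondeg F n X ∧ ∀ A ∈ Tc F n k Y, X ≤ A := by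
  classical
  let E := Fin (k + 1) → F
  have hE : finrank F E = k + 1 := Module.finrank_fin_fun F
  obtain ⟨X, hX⟩ := Submodule.exists_finrank_eq_of_le (K := F) (E := E) (m := k - 1) (by omega)
  let P : Submodule F (Dual F E) := X.dualAnnihilator
  have hP : finrank F P = 2 := by
    have := Subspace.finrank_add_finrank_dualAnnihilator_eq X
    simp only [P]
    omega
  have hD : finrank F (Dual F E) = k + 1 := Subspace.dual_finrank_eq.trans hE
  have hfin : Finite (Dual F E) := Module.finite_of_finite F
  have hcard : Nat.card {p : ℙ F (Dual F E) // p.rep ∉ P} ≤ n := by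
    have h1 := Nat.card_congr (Equiv.sumCompl fun p : ℙ F (Dual F E) => p.rep ∈ P)
    rw [Nat.card_sum, Projectivization.card_rep_mem_of_finrank_two P hP,
      Projectivization.card_of_finrank F (Dual F E) hD] at h1
    omega
  have hPtop : P < ⊤ := lt_top_iff_ne_top.2 fun h => by
    rw [h, finrank_top] at hP
    omega
  obtain ⟨b, -, hb⟩ := SetLike.exists_of_lt hPtop
  have hrep : ∀ a : Dual F E, a ∉ P → ∃ p : {p : ℙ F (Dual F E) // p.rep ∉ P},
      ∃ r : F, a = r • p.1.rep := fun a ha => by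
    have ha0 : a ≠ 0 := fun h => ha (h ▸ P.zero_mem)
    obtain ⟨r, hr⟩ := Projectivization.exists_smul_eq_mk_rep F a ha0
    refine ⟨⟨Projectivization.mk F a ha0, fun h => ha ?_⟩, (r⁻¹ : Fˣ), ?_⟩
    · rw [← hr] at h
      exact (P.smul_mem_iff_of_isUnit r.isUnit).1 h
    · rw [← hr]
      exact (inv_smul_smul r a).symm
  have hne : Nonempty {p : ℙ F (Dual F E) // p.rep ∉ P} := (hrep b hb).nonempty
  obtain ⟨f, hf⟩ : ∃ f : Fin n → {p : ℙ F (Dual F E) // p.rep ∉ P}, Function.Surjective f := by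
    let e := Finite.equivFin {p : ℙ F (Dual F E) // p.rep ∉ P}
    have hinj : Function.Injective (Fin.castLE hcard ∘ e) :=
      (Fin.castLE_injective hcard).comp e.injective
    exact ⟨_, Function.invFun_surjective hinj⟩
  have hf' : ∀ a : Dual F E, a ∉ P → ∃ i, ∃ r : F, a = r • (f i).1.rep := fun a ha => by
    obtain ⟨p, r, h⟩ := hrep a ha
    obtain ⟨i, rfl⟩ := hf p
    exact ⟨i, r, h⟩
  let φ : E →ₗ[F] (Fin n → F) := LinearMap.pi fun i => (f i).1.rep
  have hφ : Function.Injective φ := by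
    refine (injective_iff_map_eq_zero φ).2 fun x hx => ?_
    have hout : ∀ a : Dual F E, a ∉ P → a x = 0 := fun a ha => by
      obtain ⟨i, r, rfl⟩ := hf' a ha
      have : (f i).1.rep x = 0 := congrFun hx i
      simp [this]
    refine (Module.forall_dual_apply_eq_zero_iff F x).1 fun a => ?_
    by_cases ha : a ∈ P
    · have h := hout (a + b) fun h => hb ((P.add_mem_iff_right ha).1 h)
      simpa [hout b hb] using h
    · exact hout a ha
  have hmap : ∀ S : Submodule F E, finrank F (S.map φ) = finrank F S := fun S =>
    (Submodule.equivMapOfInjective φ hφ S).finrank_eq.symm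
  refine ⟨X.map φ, LinearMap.range φ, ?_, LinearMap.map_le_range, (hmap X).trans hX, ?_, ?_⟩
  · rw [LinearMap.finrank_range_of_inj hφ, hE]
  · rintro ⟨i, hi⟩
    refine (f i).2 ((Submodule.mem_dualAnnihilator _).2 fun x hx => ?_)
    exact hi (Submodule.mem_map_of_mem hx)
  · rintro A ⟨hA, hAY, hAn⟩
    have hAc : (A.comap φ).map φ = A := Submodule.map_comap_eq_of_le hAY
    have hAk : finrank F (A.comap φ) = k := by rw [← hmap, hAc, hA]
    have hlt : A.comap φ < ⊤ := lt_top_iff_ne_top.2 fun h => by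
      rw [h, finrank_top] at hAk
      omega
    obtain ⟨a, ha, hle⟩ := (A.comap φ).exists_le_ker_of_lt_top hlt
    by_cases haP : a ∈ P
    · refine Submodule.map_le_iff_le_comap.2 ?_
      rw [Submodule.eq_ker_of_le_ker (by omega) ha hle]
      exact fun x hx => (Submodule.mem_dualAnnihilator _).1 haP x hx
    · obtain ⟨i, r, rfl⟩ := hf' a haP
      refine absurd ⟨i, fun y hy => ?_⟩ hAn
      rw [← hAc] at hy
      obtain ⟨x, hx, rfl⟩ := hy
      have h : r • (f i).1.rep x = 0 := hle hx
      exact (smul_eq_zero.1 h).resolve_left fun h0 => ha (by rw [h0, zero_smul])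

/-- for `F = F_q`, `T^c(Y)` is a maximal clique of `Δ_k(V)` for every
non-degenerate `(k+1)`-dimensional `Y` iff `[k+1]_q - (q+1) > n`. -/
theorem stmt4 (F : Type*) [Field F] [Fintype F] (n k q : ℕ)
    (hq : Fintype.card F = q) (hk1 : 1 < k) (hk2 : k < n - 1) :
    (∀ Y : Submodule F (Fin n → F), finrank F ↥Y = k + 1 → IsNondeg F n Y →
        IsMaxCliqueD F n k (Tc F n k Y)) ↔
      n + (q + 1) < ∑ i ∈ Finset.range (k + 1), q ^ i := by
  rw [Fintype.card_eq_nat_card] at hq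
  subst hq
  refine ⟨fun hall => ?_, fun hc Y hY hYn => isMaxCliqueD_Tc hk1.le hY fun X hXY hX =>
    exists_mem_Tc_not_le hk1.le hc hY hYn hXY hX⟩
  by_contra! hc
  obtain ⟨X, Y, hY, hXY, hX, hXn, hT⟩ := exists_Tc_le hk1 hc
  exact not_isMaxCliqueD_Tc hk1.le (by omega) hY hXY hX hXn hT
    (hall Y hY fun ⟨i, hi⟩ => hXn ⟨i, hXY.trans hi⟩)
end

section
/- Suppose the field F has more than n−k elements and 1 < k < n−1. Let Y_1 and Y_2 be distinct non-degenerate (k+1)-dimensional subspaces of F^n (so that T^c(Y_1) and T^c(Y_2) are maximal cliques of Δ_k(V)). Then dim(Y_1 ∩ Y_2) = k if and only if for each i ∈ {1,2} and every A ∈ T^c(Y_i) there exists B ∈ T^c(Y_{3−i}) with A and B adjacent. -/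
open Module

namespace Submodule

universe u

variable {K V : Type u} [Field K] [AddCommGroup V] [Module K V] [FiniteDimensional K V]

theorem exists_between_finrank_eq {P Y : Submodule K V} (hPY : P ≤ Y) {e : ℕ}
    (hP : finrank K P ≤ e) (hY : e ≤ finrank K Y) :
    ∃ B, P ≤ B ∧ B ≤ Y ∧ finrank K B = e := by
  induction e, hP using Nat.le_induction with
  | base => exact ⟨P, le_rfl, hPY, rfl⟩
  | succ m _ ih =>
    obtain ⟨B, hPB, hBY, hB⟩ := ih (by omega)
    have hlt : B < Y := hBY.lt_of_ne (by rintro rfl; omega)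
    obtain ⟨w, hwY, hwB⟩ := SetLike.exists_of_lt hlt
    exact ⟨B ⊔ span K {w}, hPB.trans le_sup_left,
      sup_le hBY ((span_singleton_le_iff_mem _ _).2 hwY), by
        rw [finrank_sup_span_singleton hwB, hB]⟩

/-- In a pencil of subspaces between `P` and `Y`, where `Y / P` is two-dimensional, at most one
member is contained in each given subspace not containing `Y`, so fewer than `#K + 1` such
subspaces cannot catch all of them. -/
theorem exists_between_forall_not_le {P Y : Submodule K V} (hPY : P ≤ Y) {d m : ℕ}
    (hP : finrank K P = d) (hY : finrank K Y = d + 2) (S : Finset (Submodule K V))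
    (hS : S.card ≤ m + 1) (hm : (m : Cardinal) < Cardinal.mk K) (hSY : ∀ H ∈ S, ¬ Y ≤ H) :
    ∃ B, P ≤ B ∧ B ≤ Y ∧ finrank K B = d + 1 ∧ ∀ H ∈ S, ¬ B ≤ H := by
  classical
  by_cases hex : ∃ H ∈ S, P ≤ H ∧ ∃ v ∈ H, v ∈ Y ∧ v ∉ P
  · obtain ⟨H₀, hH₀, hPH₀, v, hvH₀, hvY, hvP⟩ := hex
    have hPv : finrank K (P ⊔ span K {v} : Submodule K V) = d + 1 := by
      rw [finrank_sup_span_singleton hvP, hP]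
    have hle : P ⊔ span K {v} ≤ Y := sup_le hPY ((span_singleton_le_iff_mem _ _).2 hvY)
    have hlt : P ⊔ span K {v} < Y := hle.lt_of_ne (by intro h; rw [h] at hPv; omega)
    obtain ⟨u, huY, hu⟩ := SetLike.exists_of_lt hlt
    have hspan : Y = (P ⊔ span K {v}) ⊔ span K {u} :=
      (eq_of_le_of_finrank_eq (sup_le hle ((span_singleton_le_iff_mem _ _).2 huY))
        (by rw [finrank_sup_span_singleton hu, hPv, hY])).symm
    have hY_le : ∀ H : Submodule K V, P ≤ H → v ∈ H → u ∈ H → Y ≤ H := by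
      intro H h1 h2 h3
      rw [hspan]
      exact sup_le (sup_le h1 ((span_singleton_le_iff_mem _ _).2 h2))
        ((span_singleton_le_iff_mem _ _).2 h3)
    obtain ⟨t, ht⟩ : ∃ t : K, ∀ H ∈ S.erase H₀, ¬ (P ⊔ span K {u + t • v} ≤ H) := by
      by_contra! hcon
      choose f hf hfle using hcon
      have hinj : Function.Injective (fun t : K => (⟨f t, hf t⟩ : {H // H ∈ S.erase H₀})) := by
        intro t t' htt
        have hff : f t = f t' := congrArg Subtype.val htt
        by_contra hne
        have h1 : u + t • v ∈ f t := hfle t (mem_sup_right (mem_span_singleton_self _))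
        have h2 : u + t' • v ∈ f t := by
          rw [hff]
          exact hfle t' (mem_sup_right (mem_span_singleton_self _))
        have h3 : (t - t') • v ∈ f t := by
          have := sub_mem h1 h2
          rwa [add_sub_add_left_eq_sub, ← sub_smul] at this
        have hv : v ∈ f t := (smul_mem_iff _ (sub_ne_zero.2 hne)).1 h3
        have huf : u ∈ f t := (add_mem_cancel_right (smul_mem _ _ hv)).1 h1
        exact hSY _ (Finset.mem_of_mem_erase (hf t))
          (hY_le _ (le_sup_left.trans (hfle t)) hv huf)
      have hcard := Cardinal.mk_le_of_injective hinj
      rw [Cardinal.mk_coe_finset, Finset.card_erase_of_mem hH₀] at hcard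
      have hlt := hm.trans_le hcard
      rw [Nat.cast_lt] at hlt
      omega
    have hut : u + t • v ∉ P := fun h => hu <| by
      have h1 : u + t • v ∈ P ⊔ span K {v} := mem_sup_left h
      exact (add_mem_cancel_right
        (smul_mem _ _ (mem_sup_right (mem_span_singleton_self _)))).1 h1
    refine ⟨P ⊔ span K {u + t • v}, le_sup_left, sup_le hPY
      ((span_singleton_le_iff_mem _ _).2 (add_mem huY (smul_mem _ _ hvY))), by
        rw [finrank_sup_span_singleton hut, hP], fun H hH hle => ?_⟩
    by_cases hHH : H = H₀
    · subst hHH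
      have h1 : u + t • v ∈ H := hle (mem_sup_right (mem_span_singleton_self _))
      exact hSY _ hH (hY_le _ hPH₀ hvH₀ ((add_mem_cancel_right (smul_mem _ _ hvH₀)).1 h1))
    · exact ht H (Finset.mem_erase.2 ⟨hHH, hH⟩) hle
  · push Not at hex
    obtain ⟨B, hPB, hBY, hB⟩ := exists_between_finrank_eq hPY (e := d + 1) (by omega) (by omega)
    refine ⟨B, hPB, hBY, hB, fun H hH hBH => ?_⟩
    have := finrank_mono (R := K)
      (show B ≤ P from fun v hv => hex H hH (hPB.trans hBH) v (hBH hv) (hBY hv))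
    omega

end Submodule

section CoordinateHyperplanes

universe u

variable {F : Type u} [Field F] {n : ℕ}

open Submodule

theorem mem_coordHyp {i : Fin n} {x : Fin n → F} : x ∈ coordHyp F n i ↔ x i = 0 := by
  simp [coordHyp]

theorem IsNondeg.not_le {Y : Submodule F (Fin n → F)} (h : IsNondeg F n Y) (i : Fin n) :
    ¬ Y ≤ coordHyp F n i := fun hi => h ⟨i, hi⟩

theorem finrank_coordHyp_inf {Y : Submodule F (Fin n → F)} {i : Fin n}
    (h : ¬ Y ≤ coordHyp F n i) :
    finrank F ↥(coordHyp F n i ⊓ Y) + 1 = finrank F Y := by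
  obtain ⟨w, hwY, hw⟩ := SetLike.not_le_iff_exists.1 h
  have hwi : w i ≠ 0 := fun h0 => hw (mem_coordHyp.2 h0)
  rw [← finrank_sup_span_singleton (p := coordHyp F n i ⊓ Y) (v := w) fun h0 => hw h0.1]
  suffices coordHyp F n i ⊓ Y ⊔ span F {w} = Y by rw [this]
  refine le_antisymm (sup_le inf_le_right ((span_singleton_le_iff_mem _ _).2 hwY)) fun y hy => ?_
  refine mem_sup.2 ⟨y - (y i / w i) • w, ⟨mem_coordHyp.2 ?_, sub_mem hy (smul_mem _ _ hwY)⟩,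
    (y i / w i) • w, smul_mem _ _ (mem_span_singleton_self _), sub_add_cancel _ _⟩
  simp [hwi]

open Classical in
/-- The indices of the coordinate hyperplanes containing `P`. -/
noncomputable def coordHypIndices (P : Submodule F (Fin n → F)) : Finset (Fin n) :=
  Finset.univ.filter fun i => P ≤ coordHyp F n i

theorem mem_coordHypIndices {P : Submodule F (Fin n → F)} {i : Fin n} :
    i ∈ coordHypIndices P ↔ P ≤ coordHyp F n i := by
  simp [coordHypIndices]

theorem finrank_add_card_coordHypIndices_le (P : Submodule F (Fin n → F)) :
    finrank F P + (coordHypIndices P).card ≤ n := by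
  let g : P →ₗ[F] ({i // i ∈ (coordHypIndices P)ᶜ} → F) :=
    (LinearMap.funLeft F F Subtype.val).comp P.subtype
  have hg : Function.Injective g := by
    refine (injective_iff_map_eq_zero g).2 fun x hx => Subtype.ext (funext fun i => ?_)
    by_cases hi : i ∈ coordHypIndices P
    · exact mem_coordHyp.1 (mem_coordHypIndices.1 hi x.2)
    · exact congrFun hx ⟨i, Finset.mem_compl.2 hi⟩
  have h := LinearMap.finrank_le_finrank_of_injective hg
  rw [Module.finrank_fintype_fun_eq_card, Fintype.card_coe, Finset.card_compl,
    Fintype.card_fin] at h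
  have := card_finset_fin_le (coordHypIndices P)
  omega

/-- A non-degenerate subspace `Y` has a non-degenerate hyperplane through any given subspace
of codimension two in `Y`. -/
theorem exists_isNondeg_between {k : ℕ} (hk : 1 ≤ k) (hkn : k ≤ n)
    (hF : (↑(n - k) : Cardinal) < Cardinal.mk F) {P Y : Submodule F (Fin n → F)}
    (hPY : P ≤ Y) (hP : finrank F P = k - 1) (hY : finrank F Y = k + 1)
    (hnd : IsNondeg F n Y) :
    ∃ B, P ≤ B ∧ B ≤ Y ∧ finrank F B = k ∧ IsNondeg F n B := by
  classical
  have hcard := finrank_add_card_coordHypIndices_le P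
  obtain ⟨B, hPB, hBY, hB, h⟩ := exists_between_forall_not_le hPY hP (by omega)
    ((coordHypIndices P).image (coordHyp F n))
    (Finset.card_image_le.trans (by omega)) hF (by
      simp only [Finset.mem_image]
      rintro _ ⟨i, -, rfl⟩
      exact hnd.not_le i)
  refine ⟨B, hPB, hBY, by omega, fun ⟨i, hi⟩ => h _ (Finset.mem_image_of_mem _ ?_) hi⟩
  exact mem_coordHypIndices.2 (hPB.trans hi)

/-- A non-degenerate subspace `Y` has a non-degenerate hyperplane avoiding any given nonzero
vector. -/
theorem exists_isNondeg_notMem {k : ℕ} (hk1 : 1 < k) (hk2 : k < n - 1)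
    (hF : (↑(n - k) : Cardinal) < Cardinal.mk F) {Y : Submodule F (Fin n → F)}
    (hY : finrank F Y = k + 1) (hnd : IsNondeg F n Y) {z : Fin n → F} (hz : z ≠ 0) :
    ∃ B, B ≤ Y ∧ finrank F B = k ∧ IsNondeg F n B ∧ z ∉ B := by
  classical
  obtain ⟨i, hzi⟩ := Function.ne_iff.1 hz
  set H := coordHyp F n i ⊓ Y with hH
  have hHk : finrank F H = k := by
    have := finrank_coordHyp_inf (hnd.not_le i)
    rw [← hH] at this
    omega
  obtain ⟨P, J, hPH, hP, hJ, hJB⟩ : ∃ (P : Submodule F (Fin n → F)) (J : Finset (Fin n)),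
      P ≤ H ∧ finrank F P = k - 1 ∧ J.card ≤ n - k ∧ ∀ B : Submodule F (Fin n → F),
        P ≤ B → B ≤ Y → (∀ j ∈ J, ¬ B ≤ coordHyp F n j) → IsNondeg F n B := by
    by_cases hex : ∃ j, j ≠ i ∧ H ≤ coordHyp F n j
    · obtain ⟨j, hji, hHj⟩ := hex
      obtain ⟨P, -, hPH, hP⟩ := exists_between_finrank_eq (bot_le (a := H)) (e := k - 1)
        (by simp) (by omega)
      have hjP : j ∈ coordHypIndices P := mem_coordHypIndices.2 (hPH.trans hHj)
      have hcard := finrank_add_card_coordHypIndices_le P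
      refine ⟨P, (coordHypIndices P).erase j, hPH, hP, ?_, fun B hPB hBY hB => ?_⟩
      · rw [Finset.card_erase_of_mem hjP]
        omega
      · rintro ⟨l, hl⟩
        by_cases hlj : l = j
        · subst hlj
          have hHl : H = coordHyp F n l ⊓ Y := by
            refine eq_of_le_of_finrank_eq (le_inf hHj inf_le_right) ?_
            have := finrank_coordHyp_inf (hnd.not_le l)
            omega
          refine hB i (Finset.mem_erase.2 ⟨hji.symm, mem_coordHypIndices.2 ?_⟩) ?_
          · exact hPH.trans inf_le_left
          · exact (le_inf hl hBY).trans (hHl.ge.trans inf_le_left)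
        · exact hB l (Finset.mem_erase.2 ⟨hlj, mem_coordHypIndices.2 (hPB.trans hl)⟩) hl
    · push Not at hex
      obtain ⟨Q, -, hQH, hQ⟩ := exists_between_finrank_eq (bot_le (a := H)) (e := k - 2)
        (by simp) (by omega)
      have hiQ : i ∈ coordHypIndices Q := mem_coordHypIndices.2 (hQH.trans inf_le_left)
      have hcard := finrank_add_card_coordHypIndices_le Q
      obtain ⟨P, hQP, hPH, hP, h⟩ := exists_between_forall_not_le hQH hQ (by omega)
        (((coordHypIndices Q).erase i).image (coordHyp F n))
        (Finset.card_image_le.trans (by rw [Finset.card_erase_of_mem hiQ]; omega)) hF (by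
          simp only [Finset.mem_image]
          rintro _ ⟨j, hj, rfl⟩
          exact hex j (Finset.ne_of_mem_erase hj))
      refine ⟨P, {i}, hPH, by omega, by rw [Finset.card_singleton]; omega,
        fun B hPB hBY hB => ?_⟩
      rintro ⟨l, hl⟩
      by_cases hli : l = i
      · exact hB i (Finset.mem_singleton_self i) (hli ▸ hl)
      · exact h _ (Finset.mem_image_of_mem _ (Finset.mem_erase.2
          ⟨hli, mem_coordHypIndices.2 (hQP.trans (hPB.trans hl))⟩)) (hPB.trans hl)
  have hzP : z ∉ P := fun h => hzi (mem_coordHyp.1 (hPH h).1)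
  have hPz : finrank F ↥(P ⊔ span F {z}) = k := by
    rw [finrank_sup_span_singleton hzP]
    omega
  obtain ⟨B, hPB, hBY, hB, h⟩ := exists_between_forall_not_le (hPH.trans inf_le_right) hP
    (by omega) (insert (P ⊔ span F {z}) (J.image (coordHyp F n)))
    ((Finset.card_insert_le _ _).trans (Nat.succ_le_succ (Finset.card_image_le.trans hJ))) hF (by
      simp only [Finset.mem_insert, Finset.mem_image]
      rintro _ (rfl | ⟨j, -, rfl⟩)
      · intro hle
        have := finrank_mono (R := F) hle
        omega
      · exact hnd.not_le j)
  refine ⟨B, hBY, by omega, hJB B hPB hBY fun j hj => h _ ?_, fun hzB => ?_⟩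
  · exact Finset.mem_insert_of_mem (Finset.mem_image_of_mem _ hj)
  · refine h _ (Finset.mem_insert_self _ _) (eq_of_le_of_finrank_eq
      (sup_le hPB ((span_singleton_le_iff_mem _ _).2 hzB)) ?_).ge
    omega

theorem exists_mem_Tc_adjK {k : ℕ} (hk1 : 1 < k) (hk2 : k < n - 1)
    (hF : (↑(n - k) : Cardinal) < Cardinal.mk F) {Y Y' A : Submodule F (Fin n → F)}
    (hY : finrank F Y = k + 1) (hY' : finrank F Y' = k + 1) (hnd : IsNondeg F n Y')
    (hYY' : finrank F ↥(Y ⊓ Y') = k) (hA : A ∈ Tc F n k Y) :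
    ∃ B ∈ Tc F n k Y', AdjK F n k A B := by
  obtain ⟨hAk, hAY, -⟩ := hA
  by_cases hAY' : A ≤ Y'
  · obtain ⟨z, hzA, hz⟩ := exists_mem_ne_zero_of_ne_bot (p := A)
      (by rintro rfl; simp at hAk; omega)
    obtain ⟨B, hBY, hB, hBnd, hzB⟩ := exists_isNondeg_notMem hk1 hk2 hF hY' hnd hz
    have hlt : A ⊓ B < A := inf_le_left.lt_of_ne fun h => hzB (h.ge hzA).2
    have h1 := finrank_lt_finrank_of_lt hlt
    have h2 := finrank_sup_add_finrank_inf_eq A B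
    have h3 := finrank_mono (R := F) (sup_le hAY' hBY)
    exact ⟨B, ⟨hB, hBY, hBnd⟩, by rintro rfl; exact hzB hzA, by omega⟩
  · have hlt : A ⊓ Y' < A := inf_le_left.lt_of_ne fun h => hAY' (h.ge.trans inf_le_right)
    have h1 := finrank_lt_finrank_of_lt hlt
    have h2 := finrank_sup_add_finrank_inf_eq A (Y ⊓ Y')
    rw [← inf_assoc, inf_eq_left.2 hAY] at h2
    have h3 := finrank_mono (R := F) (sup_le hAY (inf_le_left : Y ⊓ Y' ≤ Y))
    obtain ⟨B, hPB, hBY, hB, hBnd⟩ := exists_isNondeg_between hk1.le (by omega) hF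
      (inf_le_right : A ⊓ Y' ≤ Y') (by omega) hY' hnd
    have hAB : A ⊓ B = A ⊓ Y' := le_antisymm (inf_le_inf_left _ hBY) (le_inf inf_le_left hPB)
    exact ⟨B, ⟨hB, hBY, hBnd⟩, by rintro rfl; exact hAY' hBY, by rw [hAB]; omega⟩

theorem finrank_inf_eq_of_forall_adjK {k : ℕ} (hk1 : 1 < k) (hk2 : k < n - 1)
    (hF : (↑(n - k) : Cardinal) < Cardinal.mk F) {Y Y' : Submodule F (Fin n → F)}
    (hY : finrank F Y = k + 1) (hY' : finrank F Y' = k + 1) (hnd : IsNondeg F n Y)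
    (hne : Y ≠ Y') (h : ∀ A ∈ Tc F n k Y, ∃ B ∈ Tc F n k Y', AdjK F n k A B) :
    finrank F ↥(Y ⊓ Y') = k := by
  have hlt : Y ⊓ Y' < Y := inf_le_left.lt_of_ne fun h0 =>
    hne (eq_of_le_of_finrank_eq (inf_eq_left.1 h0) (by omega))
  have h1 := finrank_lt_finrank_of_lt hlt
  have key : ∀ z : Fin n → F, z ≠ 0 → ∃ W ≤ Y ⊓ Y', z ∉ W ∧ finrank F W = k - 1 := by
    intro z hz
    obtain ⟨A, hAY, hA, hAnd, hzA⟩ := exists_isNondeg_notMem hk1 hk2 hF hY hnd hz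
    obtain ⟨B, ⟨-, hBY, -⟩, -, hAB⟩ := h A ⟨hA, hAY, hAnd⟩
    exact ⟨A ⊓ B, inf_le_inf hAY hBY, fun h0 => hzA h0.1, hAB⟩
  obtain ⟨y, -, hy⟩ := exists_mem_ne_zero_of_ne_bot (p := Y)
    (by rintro rfl; simp at hY)
  obtain ⟨W, hWle, -, hW⟩ := key y hy
  have h2 := finrank_mono (R := F) hWle
  obtain ⟨z, hzZ, hz⟩ := exists_mem_ne_zero_of_ne_bot (p := Y ⊓ Y')
    (by intro h0; rw [h0, finrank_bot] at h2; omega)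
  obtain ⟨W', hle, hzW', hW'⟩ := key z hz
  have h3 := finrank_lt_finrank_of_lt (hle.lt_of_ne (by rintro rfl; exact hzW' hzZ))
  omega

end CoordinateHyperplanes

/-- for `|F| > n - k` and distinct non-degenerate `(k+1)`-dimensional
subspaces `Y₁, Y₂`, `dim (Y₁ ∩ Y₂) = k` iff every member of each of `T^c(Y₁)`, `T^c(Y₂)`
is adjacent to some member of the other. -/
theorem stmt9 (F : Type*) [Field F] (n k : ℕ)
    (hk1 : 1 < k) (hk2 : k < n - 1)
    (hF : (↑(n - k) : Cardinal) < Cardinal.mk F)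
    (Y1 Y2 : Submodule F (Fin n → F)) (hY1 : finrank F ↥Y1 = k + 1)
    (hY2 : finrank F ↥Y2 = k + 1) (hY1nd : IsNondeg F n Y1) (hY2nd : IsNondeg F n Y2)
    (hne : Y1 ≠ Y2) :
    finrank F ↥(Y1 ⊓ Y2) = k ↔
      ((∀ A ∈ Tc F n k Y1, ∃ B ∈ Tc F n k Y2, AdjK F n k A B) ∧
        (∀ A ∈ Tc F n k Y2, ∃ B ∈ Tc F n k Y1, AdjK F n k A B)) := by
  constructor
  · intro h
    exact ⟨fun A hA => exists_mem_Tc_adjK hk1 hk2 hF hY1 hY2 hY2nd h hA,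
      fun A hA => exists_mem_Tc_adjK hk1 hk2 hF hY2 hY1 hY1nd (inf_comm Y1 Y2 ▸ h) hA⟩
  · exact fun h => finrank_inf_eq_of_forall_adjK hk1 hk2 hF hY1 hY2 hY1nd hne h.1
end
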